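/- arXiv:math/0611532 — 2 statements merged into one kernel-verified Lean document; each statement's English description precedes it below -/
import Mathlib

section
/- Let f, g be polynomials with real coefficients such that g has degree m and f(T²) = T^m · g(T + T^{−1}) holds as an identity in the Laurent polynomial ring ℝ[T, T^{−1}]. Then: (i) every complex root of f has absolute value 1 if and only if every complex root of g is real and lies in the closed interval [−2, 2]; (ii) every complex root of f has absolute value 1 and is different from 1 if and only if every complex root of g is real and lies in the open interval (−2, 2). -/
open Polynomial LaurentPolynomial

theorem exists_add_inv_eq (z : ℂ) : ∃ w : ℂ, w ≠ 0 ∧ w + w⁻¹ = z := by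
  obtain ⟨s, hs⟩ := IsAlgClosed.exists_pow_nat_eq (z ^ 2 - 4) (n := 2) (by norm_num)
  have hw : (z + s) / 2 ≠ 0 := by
    intro h0
    have : s = -z := by linear_combination 2 * h0
    rw [this] at hs
    have h4 : (4 : ℂ) = 0 := by linear_combination hs
    norm_num at h4
  refine ⟨(z + s) / 2, hw, ?_⟩
  rw [← mul_left_inj' hw, add_mul, inv_mul_cancel₀ hw]
  linear_combination hs / 4

theorem add_inv_eq_of_norm_eq_one {w : ℂ} (hw : ‖w‖ = 1) : w + w⁻¹ = (2 * w.re : ℝ) := by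
  rw [Complex.inv_eq_conj hw, Complex.add_conj]

theorem norm_eq_one_iff_add_inv_mem {w : ℂ} (hw : w ≠ 0) :
    ‖w‖ = 1 ↔ (w + w⁻¹).im = 0 ∧ -2 ≤ (w + w⁻¹).re ∧ (w + w⁻¹).re ≤ 2 := by
  constructor
  · intro h
    rw [add_inv_eq_of_norm_eq_one h, Complex.ofReal_im, Complex.ofReal_re]
    have := abs_le.1 (h ▸ Complex.abs_re_le_norm w)
    exact ⟨rfl, by linarith, by linarith⟩
  · rintro ⟨him, hl, hr⟩
    have hq : (w + w⁻¹) * w = w * w + 1 := by rw [add_mul, inv_mul_cancel₀ hw]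
    generalize w + w⁻¹ = z at *
    have hre := congrArg Complex.re hq
    have him' := congrArg Complex.im hq
    simp only [Complex.mul_re, Complex.mul_im, Complex.add_re, Complex.add_im, Complex.one_re,
      Complex.one_im, him] at hre him'
    rw [← sq_eq_sq₀ (norm_nonneg w) zero_le_one, ← Complex.normSq_eq_norm_sq, Complex.normSq_apply]
    by_cases hb : w.im = 0
    · rw [hb] at hre ⊢
      rcases le_total 0 w.re with ha | ha
      · have : w.re = 1 := by nlinarith [sq_nonneg (w.re - 1)]
        rw [this]; norm_num
      · have : w.re = -1 := by nlinarith [sq_nonneg (w.re + 1)]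
        rw [this]; norm_num
    · have : z.re = 2 * w.re := mul_right_cancel₀ hb (by linear_combination him')
      rw [this] at hre
      linear_combination hre

theorem norm_eq_one_and_sq_ne_one_iff_add_inv_mem {w : ℂ} (hw : w ≠ 0) :
    ‖w‖ = 1 ∧ w ^ 2 ≠ 1 ↔
      (w + w⁻¹).im = 0 ∧ -2 < (w + w⁻¹).re ∧ (w + w⁻¹).re < 2 := by
  constructor
  · rintro ⟨h, h1⟩
    obtain ⟨him, hl, hr⟩ := (norm_eq_one_iff_add_inv_mem hw).1 h
    have hz := add_inv_eq_of_norm_eq_one h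
    have hre : (w + w⁻¹).re = 2 * w.re := by rw [hz, Complex.ofReal_re]
    have hn : w.re * w.re + w.im * w.im = 1 := by
      rw [← Complex.normSq_apply, Complex.normSq_eq_norm_sq, h, one_pow]
    have key : w.re * w.re ≠ 1 := by
      intro hsq
      have hb : w.im = 0 := by
        rw [hsq, add_eq_left] at hn
        exact mul_self_eq_zero.1 hn
      apply h1
      rw [sq]
      apply Complex.ext <;> simp [hb, hsq]
    refine ⟨him, lt_of_le_of_ne hl fun e => key ?_, lt_of_le_of_ne hr fun e => key ?_⟩
    · have : w.re = -1 := by linarith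
      rw [this]; norm_num
    · have : w.re = 1 := by linarith
      rw [this]; norm_num
  · rintro ⟨him, hl, hr⟩
    refine ⟨(norm_eq_one_iff_add_inv_mem hw).2 ⟨him, hl.le, hr.le⟩, fun h1 => ?_⟩
    rcases eq_or_eq_neg_of_sq_eq_sq w 1 (h1.trans (one_pow 2).symm) with rfl | rfl
    · norm_num at hr
    · norm_num at hl

theorem aeval_sq_eq_of_represented {f g : ℝ[X]} {m : ℕ}
    (h : aeval (T 2 : ℝ[T;T⁻¹]) f =
      (T m : ℝ[T;T⁻¹]) * aeval (T 1 + T (-1) : ℝ[T;T⁻¹]) g) {w : ℂ} (hw : w ≠ 0) :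
    aeval (w ^ 2) f = w ^ m * aeval (w + w⁻¹) g := by
  have hc : (LaurentPolynomial.eval₂ (algebraMap ℝ ℂ) (Units.mk0 w hw)).comp
      (algebraMap ℝ ℝ[T;T⁻¹]) = algebraMap ℝ ℂ := by
    ext r
    rw [RingHom.comp_apply, ← LaurentPolynomial.C_eq_algebraMap, LaurentPolynomial.eval₂_C]
  have := congrArg (LaurentPolynomial.eval₂ (algebraMap ℝ ℂ) (Units.mk0 w hw)) h
  simp only [aeval_def, map_mul, hom_eval₂, hc, map_add, LaurentPolynomial.eval₂_T] at this
  simpa [aeval_def] using this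

theorem aeval_zero_eq_leadingCoeff_of_represented {f g : ℝ[X]} {m : ℕ} (hg : g.natDegree = m)
    (h : aeval (T 2 : ℝ[T;T⁻¹]) f =
      (T m : ℝ[T;T⁻¹]) * aeval (T 1 + T (-1) : ℝ[T;T⁻¹]) g) :
    aeval (0 : ℂ) f = (g.leadingCoeff : ℂ) := by
  have heq : (fun w : ℂ => aeval (w ^ 2) f) = fun w : ℂ =>
      ∑ i ∈ Finset.range (m + 1), (g.coeff i : ℂ) * (w ^ (m - i) * (w ^ 2 + 1) ^ i) := by
    refine Continuous.ext_on (dense_compl_singleton (0 : ℂ)) (by fun_prop) (by fun_prop) ?_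
    intro w hw
    have hw : w ≠ 0 := hw
    simp only
    rw [aeval_sq_eq_of_represented h hw, aeval_eq_sum_range, hg, Finset.mul_sum]
    refine Finset.sum_congr rfl fun i hi => ?_
    have hi : i ≤ m := Nat.lt_succ_iff.1 (Finset.mem_range.1 hi)
    have : w ^ 2 + 1 = w * (w + w⁻¹) := by field_simp
    rw [this, mul_pow, Complex.real_smul, ← mul_assoc (w ^ (m - i)), ← pow_add,
      Nat.sub_add_cancel hi]
    ring
  have h0 := congrFun heq 0
  rw [Finset.sum_range_succ, Finset.sum_eq_zero] at h0
  · simpa [leadingCoeff, hg] using h0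
  · intro i hi
    have : m - i ≠ 0 := Nat.sub_ne_zero_of_lt (Finset.mem_range.1 hi)
    simp [this]

theorem forall_root_iff_of_represented {f g : ℝ[X]} {m : ℕ} (hg : g.degree = m)
    (h : aeval (T 2 : ℝ[T;T⁻¹]) f =
      (T m : ℝ[T;T⁻¹]) * aeval (T 1 + T (-1) : ℝ[T;T⁻¹]) g) {P Q : ℂ → Prop}
    (hPQ : ∀ w : ℂ, w ≠ 0 → (P (w ^ 2) ↔ Q (w + w⁻¹))) :
    (∀ z : ℂ, aeval z f = 0 → P z) ↔ ∀ z : ℂ, aeval z g = 0 → Q z := by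
  constructor
  · intro hf z hz
    obtain ⟨w, hw, rfl⟩ := exists_add_inv_eq z
    refine (hPQ w hw).1 (hf _ ?_)
    rw [aeval_sq_eq_of_represented h hw, hz, mul_zero]
  · intro hgQ z hz
    obtain ⟨w, rfl⟩ := IsAlgClosed.exists_pow_nat_eq z (n := 2) (by norm_num)
    have hw : w ≠ 0 := by
      rintro rfl
      rw [zero_pow two_ne_zero, aeval_zero_eq_leadingCoeff_of_represented
        (natDegree_eq_of_degree_eq_some hg) h, Complex.ofReal_eq_zero,
        leadingCoeff_eq_zero] at hz
      simp [hz] at hg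
    rw [aeval_sq_eq_of_represented h hw] at hz
    exact (hPQ w hw).2 (hgQ _ ((mul_eq_zero.1 hz).resolve_left (pow_ne_zero m hw)))

/-- If `f, g ∈ ℝ[T]`, `deg g = m`, and `f(T²) = T^m · g(T + T⁻¹)` in the
Laurent polynomial ring `ℝ[T,T⁻¹]`, then (i) all complex roots of `f` lie on the unit
circle iff all complex roots of `g` are real and lie in `[-2,2]`, and (ii) all complex
roots of `f` lie on the unit circle and differ from `1` iff all complex roots of `g`
are real and lie in `(-2,2)`. -/
theorem represented_polynomial_roots (f g : Polynomial ℝ) (m : ℕ) (hg : g.degree = m)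
    (h : Polynomial.aeval (T 2 : LaurentPolynomial ℝ) f =
      (T m : LaurentPolynomial ℝ) * Polynomial.aeval (T 1 + T (-1) : LaurentPolynomial ℝ) g) :
    ((∀ z : ℂ, Polynomial.aeval z (f.map (algebraMap ℝ ℂ)) = 0 → ‖z‖ = 1) ↔
      (∀ z : ℂ, Polynomial.aeval z (g.map (algebraMap ℝ ℂ)) = 0 →
        z.im = 0 ∧ -2 ≤ z.re ∧ z.re ≤ 2)) ∧
    ((∀ z : ℂ, Polynomial.aeval z (f.map (algebraMap ℝ ℂ)) = 0 → ‖z‖ = 1 ∧ z ≠ 1) ↔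
      (∀ z : ℂ, Polynomial.aeval z (g.map (algebraMap ℝ ℂ)) = 0 →
        z.im = 0 ∧ -2 < z.re ∧ z.re < 2)) := by
  simp only [aeval_map_algebraMap]
  refine ⟨forall_root_iff_of_represented hg h fun w hw => ?_,
    forall_root_iff_of_represented hg h fun w hw => ?_⟩
  · rw [norm_pow, pow_eq_one_iff_of_nonneg (norm_nonneg w) two_ne_zero]
    exact norm_eq_one_iff_add_inv_mem hw
  · rw [norm_pow, pow_eq_one_iff_of_nonneg (norm_nonneg w) two_ne_zero]
    exact norm_eq_one_and_sq_ne_one_iff_add_inv_mem hw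
end

section
/- Let p = (p_1,…,p_t) be a weight sequence of integers p_i ≥ 2 with t ≥ 3, and let q_A be the Tits quadratic form of the extended canonical algebra of weight type p, namely the integral quadratic form on the free abelian group with basis indexed by the vertex set Q₀ = {0, ω, *} ∪ {(i,j) : 1 ≤ i ≤ t, 1 ≤ j ≤ p_i−1}, given by q_A(x) = ∑_{v ∈ Q₀} x_v² − ∑_{arrows u→v} x_u x_v + (t−2)·x_0·x_ω, where the arrows are 0→(i,1), (i,j)→(i,j+1) for 1 ≤ j ≤ p_i−2, (i,p_i−1)→ω for each i = 1,…,t, and one extra arrow *→ω. Then the vector x with x_* = 1 and x_v = 2 for all other vertices v satisfies q_A(x) = −1. In particular the Tits form q_A is not weakly non-negative (it takes a negative value on a vector with non-negative entries). -/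
/-- Value of a vector at the `j`-th vertex of the arm of length `pi` (vertices
`1,…,pi-1`), where position `0` is the source `0` (value `x0`) and position `pi` is the
sink `ω` (value `xw`). -/
def armVal (pi : ℕ) (x0 xw : ℤ) (a : ℕ → ℤ) (j : ℕ) : ℤ :=
  if j = 0 then x0 else if j = pi then xw else a j

/-- The Tits quadratic form of the extended canonical algebra of weight type `p`:
`q_A(x) = ∑_v x_v² − ∑_{arrows u→v} x_u x_v + (t−2)·x₀·x_ω`, where the quiver has
vertices `0, ω, *` and arm vertices `(i,j)` (`1 ≤ j ≤ pᵢ−1`), arrows along each arm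
from `0` to `ω`, one arrow `* → ω`, and `t−2` relations from `0` to `ω`. The vector is
given by its values `x0, xw, xs` at `0, ω, *` and `a i j` at the arm vertices. -/
def titsForm {t : ℕ} (p : Fin t → ℕ) (x0 xw xs : ℤ) (a : Fin t → ℕ → ℤ) : ℤ :=
  x0 ^ 2 + xw ^ 2 + xs ^ 2 + ∑ i, ∑ j ∈ Finset.Ico 1 (p i), (a i j) ^ 2
    - ∑ i, ∑ j ∈ Finset.range (p i),
        armVal (p i) x0 xw (a i) j * armVal (p i) x0 xw (a i) (j + 1)
    - xs * xw + ((t : ℤ) - 2) * x0 * xw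

theorem armVal_const (n : ℕ) (c : ℤ) (j : ℕ) : armVal n c c (fun _ => c) j = c := by
  simp [armVal]

theorem titsForm_two_two_one {t : ℕ} (p : Fin t → ℕ) (hp : ∀ i, 1 ≤ p i) :
    titsForm p 2 2 1 (fun _ _ => 2) = -1 := by
  have hsum : ∑ i, ((p i - 1 : ℕ) : ℤ) = ∑ i, (p i : ℤ) - t := by
    simp [Nat.cast_sub (hp _)]
  simp only [titsForm, armVal_const, Finset.sum_const, Nat.card_Ico, Finset.card_range,
    nsmul_eq_mul, ← Finset.sum_mul, hsum]
  ring

/-- The vector with value `1` at the extension vertex `*` and `2` at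
all other vertices takes the value `-1` under the Tits form of the extended canonical
algebra; in particular the Tits form is not weakly non-negative. -/
theorem titsForm_not_weakly_nonneg {t : ℕ} (ht : 3 ≤ t) (p : Fin t → ℕ)
    (hp : ∀ i, 2 ≤ p i) :
    titsForm p 2 2 1 (fun _ _ => 2) = -1 ∧
    ∃ (x0 xw xs : ℤ) (a : Fin t → ℕ → ℤ),
      0 ≤ x0 ∧ 0 ≤ xw ∧ 0 ≤ xs ∧ (∀ i j, 0 ≤ a i j) ∧
      titsForm p x0 xw xs a < 0 := by
  have h := titsForm_two_two_one p fun i => one_le_two.trans (hp i)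
  exact ⟨h, 2, 2, 1, fun _ _ => 2, by simp, by simp, by simp, by simp, by simp [h]⟩
end
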